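/- If X ∈ ℤ*, d = det(X), x = det₁(X) and y = det₁(X⁻), then x·y ≡ 1 (mod d). -/

import Mathlib

/-- The determinant of the matrix `-M(X)`, where `M(X)` is the intersection matrix of
the sequence `X` (diagonal `xᵢ`, `1` on the off-diagonals `|i-j| = 1`); `det(∅) = 1`. -/
def seqDet : List ℤ → ℤ
  | [] => 1
  | [x] => -x
  | x :: y :: l => -x * seqDet (y :: l) - seqDet l

/-- `det₁(x₁,…,xₙ) = det(x₂,…,xₙ)`, with `det₁(∅) = 0`. -/
def seqDet1 : List ℤ → ℤ
  | [] => 0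
  | _ :: l => seqDet l

theorem seqDet_append_pair (a b : ℤ) : ∀ l : List ℤ,
    seqDet (l ++ [a, b]) = -b * seqDet (l ++ [a]) - seqDet l
  | [] => by simp [seqDet]; ring
  | [x] => by simp [seqDet]; ring
  | x :: y :: l => by
    have h₁ := seqDet_append_pair a b (y :: l)
    have h₂ := seqDet_append_pair a b l
    simp only [List.cons_append, seqDet] at h₁ ⊢
    linear_combination -x * h₁ - h₂

theorem seqDet_reverse : ∀ l : List ℤ, seqDet l.reverse = seqDet l
  | [] => rfl
  | [_] => rfl
  | x :: y :: l => by
    have h₁ := seqDet_reverse (y :: l)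
    have h₂ := seqDet_reverse l
    have h := seqDet_append_pair y x l.reverse
    simp only [List.reverse_cons, List.append_assoc, List.cons_append, List.nil_append,
      seqDet] at h₁ h ⊢
    rw [h, h₁, h₂]

theorem seqDet_concat_mul_seqDet_cons (a b : ℤ) (l : List ℤ) :
    seqDet (l ++ [b]) * seqDet (a :: l) = 1 + seqDet (a :: (l ++ [b])) * seqDet l := by
  induction l generalizing a with
  | nil => simp [seqDet, mul_comm]
  | cons c m ih =>
    have h := ih c
    simp only [List.cons_append, seqDet] at h ⊢
    linear_combination h

/-- **Lemma.** If `d = det(X)`, `x = det₁(X)` and `y = det₁(X⁻)`, then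
`x·y ≡ 1 (mod d)`. -/
theorem det1_mul_det1_reverse_modEq_one (X : List ℤ) :
    seqDet1 X * seqDet1 X.reverse ≡ 1 [ZMOD seqDet X] := by
  rcases X with _ | ⟨a, l⟩
  · exact Int.modEq_one
  rcases List.eq_nil_or_concat l with rfl | ⟨m, b, rfl⟩
  · rfl
  have hrev : seqDet1 (a :: (m ++ [b])).reverse = seqDet (a :: m) := by
    rw [← seqDet_reverse (a :: m)]
    simp [seqDet1]
  rw [List.concat_eq_append, hrev]
  change seqDet (m ++ [b]) * seqDet (a :: m) ≡ 1 [ZMOD _]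
  rw [seqDet_concat_mul_seqDet_cons]
  exact (Int.modEq_iff_dvd.2 ⟨seqDet m, by ring⟩ : 1 ≡ _ [ZMOD _]).symm
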